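/- If A is a compact, convex, centrally symmetric subset of a Banach space X that contains an (n+1)-dimensional ball of radius ρ (i.e., there is a subspace Y with dim Y = n+1 such that {y ∈ Y : ‖y‖ ≤ ρ} ⊆ A), then d_n(A, X) ≥ ρ. -/

import Mathlib

/-- The Kolmogorov `n`-width of a set `A` in a normed space `X`. -/
noncomputable def kolmogorovWidth {X : Type*} [NormedAddCommGroup X] [NormedSpace ℝ X]
    (n : ℕ) (A : Set X) : ℝ :=
  sInf {r : ℝ | ∃ Y : Submodule ℝ X, FiniteDimensional ℝ Y ∧ Module.finrank ℝ Y ≤ n ∧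
    r = ⨆ f : A, ⨅ g : Y, ‖(f : X) - (g : X)‖}

/-- A finite-dimensional commutative real algebra of odd dimension has a real point. -/
theorem exists_algHom_of_odd_finrank (B : Type) [CommRing B] [Algebra ℝ B] [Module.Finite ℝ B]
    (hodd : Odd (Module.finrank ℝ B)) : Nonempty (B →ₐ[ℝ] ℝ) := by
  by_contra hno
  have hN : IsNoetherianRing B := IsNoetherianRing.of_finite ℝ B
  have key : ∀ (N : Type) [AddCommGroup N] [Module B N] [Module.Finite B N] [Module ℝ N]
      [IsScalarTower ℝ B N], Even (Module.finrank ℝ N) := by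
    intro N _ _ hNf
    refine @IsNoetherianRing.induction_on_isQuotientEquivQuotientPrime B _ _ N _ _ hNf
      (fun N _ _ _ => ∀ [Module ℝ N] [IsScalarTower ℝ B N], Even (Module.finrank ℝ N))
      ?_ ?_ ?_
    · intro N _ _ _ _ _ _
      rw [Module.finrank_zero_of_subsingleton]
      exact Even.zero
    · intro N _ _ _ p e _ _
      have e' : N ≃ₗ[ℝ] B ⧸ p.1 := e.restrictScalars ℝ
      rw [e'.finrank_eq]
      have : p.1.IsPrime := p.2
      have hf : IsField (B ⧸ p.1) := by
        have : Algebra.IsIntegral ℝ (B ⧸ p.1) := inferInstance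
        have hinj : Function.Injective (algebraMap ℝ (B ⧸ p.1)) := (algebraMap ℝ (B ⧸ p.1)).injective
        exact (Algebra.IsIntegral.isField_iff_isField hinj).1 (Field.toIsField ℝ)
      let := hf.toField
      rcases Real.nonempty_algEquiv_or (B ⧸ p.1) with ⟨⟨f⟩⟩ | ⟨⟨f⟩⟩
      · exact (hno ⟨f.toAlgHom.comp (Ideal.Quotient.mkₐ ℝ p.1)⟩).elim
      · have := f.toLinearEquiv.finrank_eq
        rw [this, Complex.finrank_real_complex]
        exact even_two
    · intro N₁ _ _ _ N₂ _ _ _ N₃ _ _ _ f g hf hg hfg h1 h3 _ _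
      let : Module ℝ N₁ := Module.compHom N₁ (algebraMap ℝ B)
      let : Module ℝ N₃ := Module.compHom N₃ (algebraMap ℝ B)
      have : IsScalarTower ℝ B N₁ := IsScalarTower.of_algebraMap_smul (fun _ _ => rfl)
      have : IsScalarTower ℝ B N₃ := IsScalarTower.of_algebraMap_smul (fun _ _ => rfl)
      have h1' := h1
      have h3' := h3
      have : Module.Finite ℝ N₁ := Module.Finite.trans B N₁
      have : Module.Finite ℝ N₂ := Module.Finite.trans B N₂
      have : Module.Finite ℝ N₃ := Module.Finite.trans B N₃
      have hr := LinearMap.finrank_range_add_finrank_ker (g.restrictScalars ℝ)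
      have hrg : Module.finrank ℝ (LinearMap.range (g.restrictScalars ℝ)) = Module.finrank ℝ N₃ :=
by
        rw [LinearMap.range_eq_top.2 (show Function.Surjective (g.restrictScalars ℝ) from hg),
          finrank_top]
      have hrf : Module.finrank ℝ (LinearMap.range (f.restrictScalars ℝ)) = Module.finrank ℝ N₁ :=
        LinearMap.finrank_range_of_inj hf
      have : LinearMap.ker (g.restrictScalars ℝ) = LinearMap.range (f.restrictScalars ℝ) := by
        ext x
        exact hfg x
      rw [this, hrg, hrf] at hr
      rw [← hr]
      exact h3'.add h1'
  exact (Nat.not_even_iff_odd.2 hodd) (key B)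

open MvPolynomial

/-- image of the monomial `c` : `∏ g i ^ (c i / d) * X i ^ (c i % d)`. -/
noncomputable def monoImg {R : Type} [CommRing R] {n : ℕ} (d : ℕ)
    (g : Fin n → MvPolynomial (Fin n) R) (c : Fin n →₀ ℕ) : MvPolynomial (Fin n) R :=
  ∏ i, (g i ^ (c i / d) * X i ^ (c i % d))

theorem monoImg_totalDegree {R : Type} [CommRing R] [Nontrivial R] {n : ℕ} (d : ℕ)
    (g : Fin n → MvPolynomial (Fin n) R) (hg : ∀ i, (g i).totalDegree ≤ d) (c : Fin n →₀ ℕ) :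
    (monoImg d g c).totalDegree ≤ c.degree := by
  rw [Finsupp.degree_eq_sum]
  refine (totalDegree_finsetProd _ _).trans (Finset.sum_le_sum fun i _ => ?_)
  refine (totalDegree_mul _ _).trans ?_
  have h1 : (g i ^ (c i / d)).totalDegree ≤ (c i / d) * d :=
    (totalDegree_pow _ _).trans (Nat.mul_le_mul_left _ (hg i))
  have h2 : ((X i : MvPolynomial (Fin n) R) ^ (c i % d)).totalDegree ≤ c i % d := by
    rw [totalDegree_X_pow]
  have := Nat.div_add_mod' (c i) d
  omega

theorem monoImg_map {R S : Type} [CommRing R] [CommRing S] (φ : R →+* S) {n : ℕ} (d : ℕ)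
    (g : Fin n → MvPolynomial (Fin n) R) (c : Fin n →₀ ℕ) :
    map φ (monoImg d g c) = monoImg d (fun i => map φ (g i)) c := by
  simp [monoImg, map_prod]

theorem monoImg_X {R : Type} [CommRing R] {n : ℕ} (d : ℕ) (c : Fin n →₀ ℕ) :
    monoImg (R := R) d (fun i => X i ^ d) c = monomial c 1 := by
  rw [monoImg, monomial_eq, Finsupp.prod_fintype _ _ (by simp)]
  simp only [map_one, one_mul, ← pow_mul, ← pow_add, Nat.div_add_mod]

theorem monoImg_mul {R : Type} [CommRing R] {n : ℕ} (d : ℕ) (hd : 0 < d)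
    (g : Fin n → MvPolynomial (Fin n) R) (c : Fin n →₀ ℕ) (i : Fin n) :
    monoImg d g (c + Finsupp.single i d) = g i * monoImg d g c := by
  classical
  unfold monoImg
  rw [← Finset.mul_prod_erase _ _ (Finset.mem_univ i),
    ← Finset.mul_prod_erase (f := fun i => g i ^ (c i / d) * X i ^ (c i % d))
      (s := Finset.univ) (Finset.mem_univ i)]
  have : ∏ x ∈ Finset.univ.erase i, (g x ^ ((c + Finsupp.single i d) x / d) *
      X x ^ ((c + Finsupp.single i d) x % d)) =
      ∏ x ∈ Finset.univ.erase i, (g x ^ (c x / d) * X x ^ (c x % d)) := by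
    refine Finset.prod_congr rfl fun x hx => ?_
    have hne : i ≠ x := (Finset.ne_of_mem_erase hx).symm
    simp [hne]
  rw [this]
  simp [Nat.add_div_right _ hd, pow_succ]
  ring

/-- the linear map sending the monomial `c` to `monoImg d g c`. -/
noncomputable def monoMap {R : Type} [CommRing R] {n : ℕ} (d : ℕ)
    (g : Fin n → MvPolynomial (Fin n) R) : MvPolynomial (Fin n) R →ₗ[R] MvPolynomial (Fin n) R :=
  (basisMonomials (Fin n) R).constr R (monoImg d g)

theorem monoMap_monomial {R : Type} [CommRing R] {n : ℕ} (d : ℕ)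
    (g : Fin n → MvPolynomial (Fin n) R) (c : Fin n →₀ ℕ) (r : R) :
    monoMap d g (monomial c r) = r • monoImg d g c := by
  have : (monomial c r : MvPolynomial (Fin n) R) = r • basisMonomials (Fin n) R c := by
    simp [coe_basisMonomials, smul_monomial]
  rw [this, map_smul, monoMap, Module.Basis.constr_basis]

/-- If the linear map is bijective, the quotient algebra has dimension `d ^ n`, so
an odd `d` gives a real zero. -/
theorem exists_zero_of_bijective {n : ℕ} (d : ℕ) (hd : Odd d)
    (g : Fin n → MvPolynomial (Fin n) ℝ) (hb : Function.Bijective (monoMap d g)) :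
    ∃ x : Fin n → ℝ, ∀ i, eval x (g i) = 0 := by
  have hd0 : 0 < d := hd.pos
  let Φ : MvPolynomial (Fin n) ℝ ≃ₗ[ℝ] MvPolynomial (Fin n) ℝ := LinearEquiv.ofBijective _ hb
  have hΦ : ∀ q, Φ q = monoMap d g q := fun q => rfl
  let I : Ideal (MvPolynomial (Fin n) ℝ) := Ideal.span (Set.range g)
  let ex : (Fin n → Fin d) → (Fin n →₀ ℕ) := fun a => Finsupp.equivFunOnFinite.symm (fun i => (a i : ℕ))
  have hexi : Function.Injective ex := by
    intro a b hab
    funext i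
    have := DFunLike.congr_fun hab i
    exact Fin.ext (by simpa [ex] using this)
  let ψ₀ : MvPolynomial (Fin n) ℝ →ₗ[ℝ] ((Fin n → Fin d) → ℝ) :=
    LinearMap.pi (fun a => lcoeff ℝ (ex a))
  let ψ := ψ₀ ∘ₗ Φ.symm.toLinearMap
  have hψ₀ : ∀ q a, ψ₀ q a = coeff (ex a) q := fun q a => rfl
  have hψ : ∀ q a, ψ q a = coeff (ex a) (Φ.symm q) := fun q a => rfl
  have hsurj : Function.Surjective ψ := by
    intro w
    refine ⟨Φ (∑ a, monomial (ex a) (w a)), ?_⟩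
    funext a
    rw [hψ, LinearEquiv.symm_apply_apply, coeff_sum]
    simp [coeff_monomial, hexi.eq_iff]
  have hker : LinearMap.ker ψ = I.restrictScalars ℝ := by
    apply le_antisymm
    · intro q hq
      obtain ⟨r, rfl⟩ := Φ.surjective q
      have hr : ∀ a, coeff (ex a) r = 0 := by
        intro a
        have := congrFun (LinearMap.mem_ker.1 hq) a
        rwa [hψ, LinearEquiv.symm_apply_apply] at this
      rw [Submodule.restrictScalars_mem, hΦ, r.as_sum, map_sum]
      refine Submodule.sum_mem _ fun c hc => ?_
      rw [monoMap_monomial]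
      by_cases hcd : ∀ i, c i < d
      · exfalso
        refine (mem_support_iff.1 hc) ?_
        have := hr (fun i => ⟨c i, hcd i⟩)
        convert this
        ext i
        simp [ex]
      · push Not at hcd
        obtain ⟨i, hi⟩ := hcd
        have hc' : c = (c - Finsupp.single i d) + Finsupp.single i d := by
          ext j
          by_cases hj : i = j
          · subst hj; simp; omega
          · simp [hj]
        rw [hc', monoImg_mul d hd0, smul_eq_C_mul]
        exact I.mul_mem_left _ (I.mul_mem_right _ (Ideal.subset_span ⟨i, rfl⟩))
    · intro q hq
      obtain ⟨a, rfl⟩ := (Ideal.mem_span_range_iff_exists_fun).1 (show q ∈ I from hq)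
      refine Submodule.sum_mem _ fun i _ => ?_
      obtain ⟨r, hr⟩ := Φ.surjective (a i)
      rw [← hr, hΦ, r.as_sum, map_sum, Finset.sum_mul]
      refine Submodule.sum_mem _ fun c _ => ?_
      have h1 : monoMap d g (monomial c (coeff c r)) * g i =
          Φ (monomial (c + Finsupp.single i d) (coeff c r)) := by
        rw [hΦ, monoMap_monomial, monoMap_monomial, monoImg_mul d hd0, smul_mul_assoc, mul_comm]
      rw [h1, LinearMap.mem_ker]
      funext b
      rw [hψ, LinearEquiv.symm_apply_apply, coeff_monomial, if_neg]
      · rfl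
      · intro h
        have := DFunLike.congr_fun h i
        have h2 := (b i).2
        simp [ex] at this
        omega
  have hI : Module.finrank ℝ (MvPolynomial (Fin n) ℝ ⧸ I) = d ^ n ∧
      Module.Finite ℝ (MvPolynomial (Fin n) ℝ ⧸ I) := by
    have e1 : (MvPolynomial (Fin n) ℝ ⧸ LinearMap.ker ψ) ≃ₗ[ℝ] ((Fin n → Fin d) → ℝ) :=
      ψ.quotKerEquivOfSurjective hsurj
    have e2 : (MvPolynomial (Fin n) ℝ ⧸ I) ≃ₗ[ℝ] (MvPolynomial (Fin n) ℝ ⧸ LinearMap.ker ψ) :=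
      (Submodule.Quotient.restrictScalarsEquiv ℝ I).symm ≪≫ₗ
        Submodule.quotEquivOfEq _ _ hker.symm
    have e := e2 ≪≫ₗ e1
    refine ⟨?_, Module.Finite.equiv e.symm⟩
    rw [e.finrank_eq]
    simp
  have := hI.2
  obtain ⟨f⟩ := exists_algHom_of_odd_finrank (MvPolynomial (Fin n) ℝ ⧸ I)
    (by rw [hI.1]; exact hd.pow)
  let F := f.comp (Ideal.Quotient.mkₐ ℝ I)
  refine ⟨fun i => F (X i), fun i => ?_⟩
  have hF : aeval (fun i => F (X i)) = F := by
    ext i; simp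
  have h0 : F (g i) = 0 := by
    have : Ideal.Quotient.mkₐ ℝ I (g i) = 0 :=
      Ideal.Quotient.eq_zero_iff_mem.2 (Ideal.subset_span ⟨i, rfl⟩)
    simp only [F, AlgHom.comp_apply, this, map_zero]
  rw [← hF] at h0
  simpa [aeval_eq_eval] using h0

/-- Generic bijectivity. -/
theorem exists_zero_generic {n : ℕ} (d : ℕ) (hd : Odd d)
    (p : Fin n → MvPolynomial (Fin n) ℝ) (hp : ∀ i, (p i).totalDegree ≤ d) :
    ∃ S : Set ℝ, S.Countable ∧ ∀ s ∉ S, ∃ x : Fin n → ℝ, ∀ i, x i ^ d + s * eval x (p i) = 0 := by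
  classical
  let G : Fin n → MvPolynomial (Fin n) (Polynomial ℝ) :=
    fun i => X i ^ d + C Polynomial.X * map Polynomial.C (p i)
  let gs : ℝ → Fin n → MvPolynomial (Fin n) ℝ := fun s i => X i ^ d + C s * p i
  have hG : ∀ s i, map (Polynomial.evalRingHom s) (G i) = gs s i := by
    intro s i
    have : (Polynomial.evalRingHom s).comp Polynomial.C = RingHom.id ℝ := by
      ext; simp
    simp [G, gs, map_map, this, MvPolynomial.map_id]
  have hgs : ∀ s i, (gs s i).totalDegree ≤ d := by
    intro s i
    refine (totalDegree_add _ _).trans (max_le ?_ ?_)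
    · rw [totalDegree_X_pow]
    · refine (totalDegree_mul _ _).trans ?_
      simpa using hp i
  let ι : ℕ → Type := fun m => {c : Fin n →₀ ℕ // c.degree ≤ m}
  have hfin : ∀ m, Finite (ι m) := fun m => (Finsupp.finite_of_degree_le m).to_subtype
  let : ∀ m, Fintype (ι m) := fun m => Fintype.ofFinite _
  let M : ∀ m, Matrix (ι m) (ι m) (Polynomial ℝ) := fun m =>
    Matrix.of fun c' c => coeff c'.1 (monoImg d G c.1)
  let Ms : ℝ → ∀ m, Matrix (ι m) (ι m) ℝ := fun s m =>
    Matrix.of fun c' c => coeff c'.1 (monoImg d (gs s) c.1)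
  have hMs : ∀ s m, (Ms s m).det = (M m).det.eval s := by
    intro s m
    rw [← Polynomial.coe_evalRingHom, RingHom.map_det]
    congr 1
    ext c' c
    simp only [Ms, M, RingHom.mapMatrix_apply, Matrix.map_apply, Matrix.of_apply]
    rw [← coeff_map, monoImg_map]
    simp only [hG]
  have hM0 : ∀ m, (M m).det ≠ 0 := by
    intro m h0
    have h1 := hMs 0 m
    have h2 : Ms 0 m = 1 := by
      ext c' c
      have : gs 0 = fun i => X i ^ d := by
        funext i; simp [gs]
      simp only [Ms, Matrix.of_apply, this, monoImg_X, coeff_monomial, Matrix.one_apply]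
      by_cases h : c' = c
      · simp [h]
      · have h' : ¬ c.1 = c'.1 := fun e => h (Subtype.ext e.symm)
        rw [if_neg h', if_neg h]
    rw [h0, h2] at h1
    simp at h1
  refine ⟨⋃ m, {s | (M m).det.IsRoot s}, Set.countable_iUnion fun m =>
    (Polynomial.finite_setOfPred_isRoot (hM0 m)).countable, fun s hs => ?_⟩
  have hdet : ∀ m, (Ms s m).det ≠ 0 := by
    intro m h
    apply hs
    rw [Set.mem_iUnion]
    exact ⟨m, by rw [Set.mem_ofPred_eq, Polynomial.IsRoot.def, ← hMs, h]⟩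
  have hexp : ∀ m (v : ι m → ℝ) (c' : ι m),
      coeff c'.1 (monoMap d (gs s) (∑ c, monomial c.1 (v c))) = (Ms s m).mulVec v c' := by
    intro m v c'
    rw [map_sum, coeff_sum]
    simp only [monoMap_monomial, coeff_smul, Matrix.mulVec, dotProduct, Ms, Matrix.of_apply,
      smul_eq_mul, mul_comm]
  have hcoeff : ∀ (q : MvPolynomial (Fin n) ℝ) (m : ℕ) (c : Fin n →₀ ℕ), q.totalDegree ≤ m →
      ¬ c.degree ≤ m → coeff c q = 0 := by
    intro q m c hq hc
    apply coeff_eq_zero_of_totalDegree_lt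
    have : c.degree = ∑ i ∈ c.support, c i := rfl
    omega
  have hsum : ∀ (q : MvPolynomial (Fin n) ℝ) (m : ℕ), q.totalDegree ≤ m →
      q = ∑ c : ι m, monomial c.1 (coeff c.1 q) := by
    intro q m hq
    ext c
    rw [coeff_sum]
    simp only [coeff_monomial]
    by_cases hc : c.degree ≤ m
    · rw [Finset.sum_eq_single (⟨c, hc⟩ : ι m)]
      · simp
      · intro b _ hb
        rw [if_neg]
        intro h
        exact hb (Subtype.ext h)
      · simp
    · rw [hcoeff q m c hq hc, Finset.sum_eq_zero]
      intro b _
      rw [if_neg]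
      rintro rfl
      exact hc b.2
  have hb : Function.Bijective (monoMap d (gs s)) := by
    constructor
    · rw [← LinearMap.ker_eq_bot, LinearMap.ker_eq_bot']
      intro q hq
      have h1 := hsum q _ le_rfl
      have h2 : (Ms s q.totalDegree).mulVec (fun c => coeff c.1 q) = 0 := by
        funext c'
        rw [← hexp, ← h1, hq]
        simp
      have h3 := Matrix.eq_zero_of_mulVec_eq_zero (hdet _) h2
      rw [h1]
      refine Finset.sum_eq_zero fun c _ => ?_
      have := congrFun h3 c
      simp only [Pi.zero_apply] at this
      rw [this, map_zero]
    · intro q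
      set m := q.totalDegree with hm
      have hu : IsUnit (Ms s m).det := isUnit_iff_ne_zero.2 (hdet m)
      let v : ι m → ℝ := (Ms s m)⁻¹.mulVec (fun c => coeff c.1 q)
      have hv : (Ms s m).mulVec v = fun c => coeff c.1 q := by
        simp only [v, Matrix.mulVec_mulVec, Matrix.mul_nonsing_inv _ hu, Matrix.one_mulVec]
      refine ⟨∑ c, monomial c.1 (v c), ?_⟩
      ext c
      by_cases hc : c.degree ≤ m
      · have := hexp m v ⟨c, hc⟩
        rw [hv] at this
        exact this
      · rw [hcoeff q m c le_rfl hc, map_sum, coeff_sum]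
        refine Finset.sum_eq_zero fun b _ => ?_
        rw [monoMap_monomial, coeff_smul,
          hcoeff _ m c ((monoImg_totalDegree d (gs s) (hgs s) b.1).trans b.2) hc, smul_zero]
  obtain ⟨x, hx⟩ := exists_zero_of_bijective d hd (gs s) hb
  refine ⟨x, fun i => ?_⟩
  simpa [gs] using hx i

/-- Odd forms that are sums of powers of linear forms have a common zero on the sphere. -/
theorem exists_common_zero {Y : Type*} [NormedAddCommGroup Y] [NormedSpace ℝ Y]
    [FiniteDimensional ℝ Y] {n : ℕ} (hdim : Module.finrank ℝ Y = n + 1)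
    {κ : Type*} [Fintype κ] (φ : κ → Y →ₗ[ℝ] ℝ) (a : Fin n → κ → ℝ) (d : ℕ) (hd : Odd d) :
    ∃ u : Y, ‖u‖ = 1 ∧ ∀ i, ∑ k, a i k * φ k u ^ d = 0 := by
  let b : Module.Basis (Fin (n + 1)) ℝ Y := Module.finBasisOfFinrankEq ℝ Y hdim
  let p : Fin n → MvPolynomial (Fin n) ℝ := fun i =>
    ∑ k, C (a i k) * (C (φ k (b 0)) + ∑ j, C (φ k (b j.succ)) * X j) ^ d
  have hp : ∀ i, (p i).totalDegree ≤ d := by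
    intro i
    refine totalDegree_finsetSum_le fun k _ => ?_
    refine (totalDegree_mul _ _).trans ?_
    rw [totalDegree_C, zero_add]
    refine (totalDegree_pow _ _).trans ?_
    have : (C (φ k (b 0)) + ∑ j, C (φ k (b j.succ)) * X j :
        MvPolynomial (Fin n) ℝ).totalDegree ≤ 1 := by
      refine (totalDegree_add _ _).trans (max_le (by simp) ?_)
      refine totalDegree_finsetSum_le fun j _ => ?_
      refine (totalDegree_mul _ _).trans ?_
      simp
    calc _ ≤ d * 1 := Nat.mul_le_mul_left _ this
      _ = d := mul_one d
  obtain ⟨S, hS, hz⟩ := exists_zero_generic d hd p hp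
  have happ : ∀ N : ℝ, ∃ s, N < s ∧ ∃ u : Y, ‖u‖ = 1 ∧
      ∀ i : Fin n, (b.coord i.succ u) ^ d + s * ∑ k, a i k * φ k u ^ d = 0 := by
    intro N
    obtain ⟨s, hsS, hsN⟩ := (hS.dense_compl ℝ).exists_gt N
    obtain ⟨x, hx⟩ := hz s hsS
    let y : Y := b 0 + ∑ j, x j • b j.succ
    have hy0 : b.coord 0 y = 1 := by
      simp [y, Finsupp.single_apply]
    have hyi : ∀ i : Fin n, b.coord i.succ y = x i := by
      intro i
      simp [y, Finsupp.single_apply]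
    have hyne : y ≠ 0 := by
      intro h
      rw [h, map_zero] at hy0
      exact zero_ne_one hy0
    have hev : ∀ i, eval x (p i) = ∑ k, a i k * φ k y ^ d := by
      intro i
      simp only [p, y, map_sum, map_mul, map_pow, map_add, eval_C, eval_X, map_smul, smul_eq_mul]
      simp only [mul_comm (x _)]
    refine ⟨s, hsN, ‖y‖⁻¹ • y, ?_, fun i => ?_⟩
    · rw [norm_smul, norm_inv, norm_norm, inv_mul_cancel₀ (norm_ne_zero_iff.2 hyne)]
    · have h1 := hx i
      rw [hev, ← hyi] at h1
      simp only [map_smul, smul_eq_mul, mul_pow]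
      have h2 : ∑ k, a i k * ((‖y‖⁻¹) ^ d * φ k y ^ d) =
          (‖y‖⁻¹) ^ d * ∑ k, a i k * φ k y ^ d := by
        rw [Finset.mul_sum]
        exact Finset.sum_congr rfl fun k _ => by ring
      rw [h2]
      linear_combination (‖y‖⁻¹) ^ d * h1
  have : Nontrivial Y := Module.nontrivial_of_finrank_pos (R := ℝ) (by omega)
  have hproper : ProperSpace Y := FiniteDimensional.proper ℝ Y
  have hcomp : IsCompact (Metric.sphere (0 : Y) 1) := isCompact_sphere 0 1
  have hne : (Metric.sphere (0 : Y) 1).Nonempty := NormedSpace.sphere_nonempty.2 zero_le_one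
  have hcφ : ∀ k, Continuous (φ k) := fun k => (φ k).continuous_of_finiteDimensional
  have hcb : ∀ i, Continuous (b.coord i) := fun i => (b.coord i).continuous_of_finiteDimensional
  let H : Y → ℝ := fun u => ∑ i, |∑ k, a i k * φ k u ^ d|
  let T : Y → ℝ := fun u => ∑ i : Fin n, |b.coord i.succ u ^ d|
  have hH : Continuous H := by fun_prop
  have hT : Continuous T := by fun_prop
  obtain ⟨u0, hu0, hmin⟩ := hcomp.exists_isMinOn hne hH.continuousOn
  obtain ⟨u1, hu1, hmax⟩ := hcomp.exists_isMaxOn hne hT.continuousOn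
  have hH0 : 0 ≤ H u0 := Finset.sum_nonneg fun i _ => abs_nonneg _
  have hHz : H u0 = 0 := by
    by_contra hne0
    have hpos : 0 < H u0 := lt_of_le_of_ne hH0 (Ne.symm hne0)
    have hT1 : 0 ≤ T u1 := Finset.sum_nonneg fun i _ => abs_nonneg _
    obtain ⟨s, hs, u, hu, hui⟩ := happ (T u1 / H u0)
    have hspos : 0 < s := lt_of_le_of_lt (by positivity) hs
    have hmem : u ∈ Metric.sphere (0 : Y) 1 := by simpa using hu
    have h1 : H u0 ≤ H u := hmin hmem
    have h2 : T u ≤ T u1 := hmax hmem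
    have h3 : T u = s * H u := by
      simp only [T, H, Finset.mul_sum]
      refine Finset.sum_congr rfl fun i _ => ?_
      rw [eq_neg_of_add_eq_zero_left (hui i), abs_neg, abs_mul, abs_of_pos hspos]
    rw [div_lt_iff₀ hpos] at hs
    nlinarith [mul_le_mul_of_nonneg_left h1 hspos.le]
  refine ⟨u0, by simpa using hu0, fun i => ?_⟩
  have := (Finset.sum_eq_zero_iff_of_nonneg (fun i _ => abs_nonneg _)).1 hHz i (Finset.mem_univ i)
  exact abs_eq_zero.1 this

/-- Tangent line inequality for even powers. -/
theorem even_pow_tangent (m : ℕ) (a t : ℝ) :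
    a ^ (2 * (m + 1)) + (2 * (m + 1)) * (t * a ^ (2 * m + 1)) ≤ (a + t) ^ (2 * (m + 1)) := by
  have hE : Even (2 * (m + 1)) := even_two_mul _
  rcases eq_or_ne a 0 with rfl | ha
  · simp only [zero_add]
    rw [zero_pow (by omega), zero_pow (by omega)]
    simpa using hE.pow_nonneg t
  · have hB : ∀ x : ℝ, 1 + (2 * (m + 1)) * x ≤ (1 + x) ^ (2 * (m + 1)) := by
      intro x
      by_cases hx : -2 ≤ x
      · have := one_add_mul_le_pow hx (2 * (m + 1))
        push_cast at this
        exact this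
      · push Not at hx
        refine le_trans ?_ (hE.pow_nonneg _)
        have : (0 : ℝ) ≤ m := Nat.cast_nonneg m
        nlinarith
    have h := mul_le_mul_of_nonneg_left (hB (t / a)) (hE.pow_nonneg a)
    rw [← mul_pow, mul_add, mul_one, mul_one_add, mul_div_cancel₀ _ ha] at h
    refine le_trans (le_of_eq ?_) h
    rw [show 2 * (m + 1) = 2 * m + 1 + 1 by ring, pow_succ]
    field_simp

/-- Approximate Krein-Krasnoselskii-Milman theorem. -/
theorem exists_almost_orthogonal {X : Type*} [NormedAddCommGroup X] [NormedSpace ℝ X]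
    (n : ℕ) (Y V : Submodule ℝ X) [FiniteDimensional ℝ Y] [FiniteDimensional ℝ V]
    (hY : Module.finrank ℝ Y = n + 1) (hV : Module.finrank ℝ V ≤ n)
    (θ : ℝ) (h0 : 0 < θ) (h1 : θ < 1) :
    ∃ u ∈ Y, ‖u‖ = 1 ∧ ∀ v ∈ V, θ ^ 2 ≤ ‖u + v‖ := by
  classical
  -- norming functionals
  have hproper : ProperSpace Y := FiniteDimensional.proper ℝ Y
  have hcomp : IsCompact (Metric.sphere (0 : Y) 1) := isCompact_sphere 0 1
  have hex : ∀ u : Y, ∃ f : X →L[ℝ] ℝ, ‖f‖ ≤ 1 ∧ f (u : X) = ‖(u : X)‖ := by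
    intro u
    obtain ⟨f, hf, hfu⟩ := exists_dual_vector'' ℝ (u : X)
    exact ⟨f, hf, by simpa using hfu⟩
  choose f hf hfu using hex
  obtain ⟨t, ht⟩ := hcomp.elim_finite_subcover (fun u : Y => {w : Y | θ < f u (w : X)})
    (fun u => isOpen_lt continuous_const ((f u).continuous.comp continuous_subtype_val))
    (by
      intro u hu
      rw [Set.mem_iUnion]
      refine ⟨u, ?_⟩
      have : ‖(u : X)‖ = 1 := by simpa using hu
      change θ < f u (u : X)
      rw [hfu, this]
      exact h1)
  have hcover : ∀ u : Y, ‖u‖ = 1 → ∃ k : t, θ < f k.1 (u : X) := by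
    intro u hu
    have := ht (show u ∈ Metric.sphere (0 : Y) 1 by simpa using hu)
    rw [Set.mem_iUnion₂] at this
    obtain ⟨k, hk, hkk⟩ := this
    exact ⟨⟨k, hk⟩, hkk⟩
  obtain ⟨vs, hvs⟩ : ∃ vs : Fin n → V, Submodule.span ℝ (Set.range vs) = ⊤ := by
    let bV := Module.finBasis ℝ V
    refine ⟨fun i => if h : (i : ℕ) < Module.finrank ℝ V then bV ⟨i, h⟩ else 0, ?_⟩
    rw [eq_top_iff, ← bV.span_eq]
    refine Submodule.span_mono ?_
    rintro _ ⟨j, rfl⟩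
    exact ⟨⟨j, lt_of_lt_of_le j.2 hV⟩, by simp⟩
  obtain ⟨m, hm⟩ : ∃ m : ℕ, (Fintype.card t : ℝ) * θ ^ (2 * (m + 1)) ≤ 1 := by
    have hlim : Filter.Tendsto (fun m : ℕ => (Fintype.card t : ℝ) * θ ^ m) Filter.atTop
        (nhds ((Fintype.card t : ℝ) * 0)) :=
      (tendsto_pow_atTop_nhds_zero_of_lt_one h0.le h1).const_mul _
    rw [mul_zero] at hlim
    obtain ⟨M, hM⟩ := Filter.eventually_atTop.1 (hlim.eventually_le_const zero_lt_one)
    exact ⟨M, hM _ (by omega)⟩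
  obtain ⟨u, hu, hz⟩ := exists_common_zero hY (κ := t)
    (fun k => (f k.1).toLinearMap ∘ₗ Y.subtype) (fun i k => f k.1 (vs i : X)) (2 * m + 1)
    (odd_two_mul_add_one m)
  have hz' : ∀ v : V, ∑ k : t, f k.1 (v : X) * f k.1 (u : X) ^ (2 * m + 1) = 0 := by
    intro v
    have hv : v ∈ Submodule.span ℝ (Set.range vs) := by rw [hvs]; trivial
    induction hv using Submodule.span_induction with
    | mem x hx =>
      obtain ⟨i, rfl⟩ := hx
      exact hz i
    | zero => simp
    | add x y _ _ hx hy =>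
      simp only [Submodule.coe_add, map_add, add_mul, Finset.sum_add_distrib, hx, hy, add_zero]
    | smul c x _ hx =>
      simp only [Submodule.coe_smul, map_smul, smul_eq_mul, mul_assoc, ← Finset.mul_sum, hx,
        mul_zero]
  refine ⟨u, u.2, hu, fun v hv => ?_⟩
  have hE : Even (2 * (m + 1)) := even_two_mul _
  have hA : ∑ k : t, f k.1 (u : X) ^ (2 * (m + 1)) ≤
      ∑ k : t, f k.1 ((u : X) + v) ^ (2 * (m + 1)) := by
    have := Finset.sum_le_sum (s := Finset.univ)
      (fun (k : t) _ => even_pow_tangent m (f k.1 (u : X)) (f k.1 v))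
    rw [Finset.sum_add_distrib, ← Finset.mul_sum, hz' ⟨v, hv⟩, mul_zero, add_zero] at this
    simpa only [map_add] using this
  have hB : ∑ k : t, f k.1 ((u : X) + v) ^ (2 * (m + 1)) ≤
      Fintype.card t * ‖(u : X) + v‖ ^ (2 * (m + 1)) := by
    have : ∀ k ∈ (Finset.univ : Finset t), f k.1 ((u : X) + v) ^ (2 * (m + 1)) ≤
        ‖(u : X) + v‖ ^ (2 * (m + 1)) := by
      intro k _
      rw [← hE.pow_abs]
      refine pow_le_pow_left₀ (abs_nonneg _) ?_ _
      have := (f k.1).le_of_opNorm_le (hf k.1) ((u : X) + v)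
      rwa [one_mul, Real.norm_eq_abs] at this
    have := Finset.sum_le_card_nsmul _ _ _ this
    rwa [nsmul_eq_mul, Finset.card_univ] at this
  obtain ⟨k0, hk0⟩ := hcover u hu
  have hC : θ ^ (2 * (m + 1)) ≤ ∑ k : t, f k.1 (u : X) ^ (2 * (m + 1)) :=
    (pow_le_pow_left₀ h0.le hk0.le _).trans
      (Finset.single_le_sum (f := fun k : t => f k.1 (u : X) ^ (2 * (m + 1)))
        (fun k _ => hE.pow_nonneg _) (Finset.mem_univ k0))
  by_contra hlt
  push Not at hlt
  have hcard : (0 : ℝ) < Fintype.card t := by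
    exact_mod_cast Fintype.card_pos_iff.2 ⟨k0⟩
  have hD : ‖(u : X) + v‖ ^ (2 * (m + 1)) < (θ ^ 2) ^ (2 * (m + 1)) :=
    pow_lt_pow_left₀ hlt (norm_nonneg _) (by omega)
  have hF : (θ ^ 2) ^ (2 * (m + 1)) = θ ^ (2 * (m + 1)) * θ ^ (2 * (m + 1)) := by
    rw [← pow_mul, ← pow_add]; congr 1; ring
  have hpos : 0 < θ ^ (2 * (m + 1)) := pow_pos h0 _
  rw [hF] at hD
  have := mul_lt_mul_of_pos_left hD hcard
  nlinarith [mul_le_mul_of_nonneg_right hm hpos.le]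

/-- Ball inclusion lower bound: if a compact, convex, centrally symmetric set `A` contains an
`(n+1)`-dimensional ball of radius `ρ`, then `d_n(A, X) ≥ ρ`. -/
theorem kolmogorovWidth_ge_of_ball_subset {X : Type*} [NormedAddCommGroup X] [NormedSpace ℝ X]
    [CompleteSpace X] (A : Set X) (hcomp : IsCompact A) (hconv : Convex ℝ A)
    (hsymm : ∀ x ∈ A, -x ∈ A)
    (n : ℕ) (Y : Submodule ℝ X) (hfin : FiniteDimensional ℝ Y)
    (hdim : Module.finrank ℝ Y = n + 1)
    (ρ : ℝ) (hρ : 0 ≤ ρ) (hball : {y : X | y ∈ Y ∧ ‖y‖ ≤ ρ} ⊆ A) :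
    ρ ≤ kolmogorovWidth n A := by
  refine le_csInf ⟨_, ⊥, inferInstance, by simp, rfl⟩ ?_
  rintro r ⟨V, hVfin, hV, rfl⟩
  obtain ⟨K, hK⟩ := hcomp.isBounded.exists_norm_le
  have hbelow : ∀ f : A, BddBelow (Set.range fun g : V => ‖(f : X) - (g : X)‖) := fun f =>
    ⟨0, by rintro _ ⟨g, rfl⟩; exact norm_nonneg _⟩
  have hbdd : BddAbove (Set.range fun f : A => ⨅ g : V, ‖(f : X) - (g : X)‖) := by
    refine ⟨K, ?_⟩
    rintro _ ⟨f, rfl⟩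
    refine (ciInf_le (hbelow f) 0).trans ?_
    simpa using hK f f.2
  have key : ∀ θ : ℝ, 0 < θ → θ < 1 →
      ρ * θ ^ 2 ≤ ⨆ f : A, ⨅ g : V, ‖(f : X) - (g : X)‖ := by
    intro θ h0 h1
    obtain ⟨u, huY, hu, huV⟩ := exists_almost_orthogonal n Y V hdim hV θ h0 h1
    have hmem : ρ • u ∈ A := hball ⟨Y.smul_mem _ huY, by
      rw [norm_smul, hu, mul_one, Real.norm_of_nonneg hρ]⟩
    refine le_trans ?_ (le_ciSup hbdd ⟨ρ • u, hmem⟩)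
    refine le_ciInf fun g => ?_
    rcases hρ.eq_or_lt with h | h
    · have h5 : ρ * θ ^ 2 = 0 := by rw [← h, zero_mul]
      exact h5.le.trans (norm_nonneg _)
    · have h2 := huV (-(ρ⁻¹ • (g : X))) (V.neg_mem (V.smul_mem _ g.2))
      have h3 : ρ • u - (g : X) = ρ • (u + -(ρ⁻¹ • (g : X))) := by
        rw [smul_add, smul_neg, smul_inv_smul₀ h.ne', sub_eq_add_neg]
      change ρ * θ ^ 2 ≤ ‖ρ • u - (g : X)‖
      rw [h3, norm_smul, Real.norm_of_nonneg hρ]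
      exact mul_le_mul_of_nonneg_left h2 hρ
  have hlim : Filter.Tendsto (fun θ : ℝ => ρ * θ ^ 2) (nhdsWithin 1 (Set.Iio 1)) (nhds ρ) := by
    have : Filter.Tendsto (fun θ : ℝ => ρ * θ ^ 2) (nhds 1) (nhds (ρ * 1 ^ 2)) :=
      (Continuous.tendsto (by fun_prop) 1)
    rw [one_pow, mul_one] at this
    exact this.mono_left nhdsWithin_le_nhds
  refine le_of_tendsto hlim ?_
  filter_upwards [Ioo_mem_nhdsLT (zero_lt_one (α := ℝ))] with θ hθ
  exact key θ hθ.1 hθ.2
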